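/- Let α ≥ 1 be an integer, let z > w > 0 be real, and define Q(s) = (z^2-w^2)^2 - 2s^2(z^2+w^2) + s^4 and R(s) = Q(s)^{(2α-1)/2} for s in a neighborhood of 0 where Q > 0. Let D_s denote the operator D_sφ(s) = (1/s)φ'(s). Then for every integer j with 0 ≤ j ≤ α-1, the function D_s^j R extends continuously to s = 0 and its value there equals Σ_{q=⌈j/2⌉}^{j} (-1)^j (2α)! (α-q)! j! / ((2α-2q)! α! (2q-j)! (j-q)!) · (z^2-w^2)^{2α-2q-1} (z^2+w^2)^{2q-j}. -/

import Mathlib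

/-- The differential operator `D_s = (1/s) d/ds`. -/
noncomputable def Dop (φ : ℝ → ℝ) : ℝ → ℝ := fun s => (1 / s) * deriv φ s

/-- `j! / ((j - 2p)! p!)`, the number of terms with `p` second derivatives in the `j`-fold
derivative of a composition with a quadratic; it vanishes for `j < 2p`. -/
noncomputable def quadCoeff (j p : ℕ) : ℝ := (j.descFactorial (2 * p) : ℝ) / (p.factorial : ℝ)

/-- `4 ^ q` times the falling factorial `β (β - 1) ⋯ (β - q + 1)`. -/
noncomputable def scaledFalling (β : ℝ) (q : ℕ) : ℝ := ∏ i ∈ Finset.range q, (4 * (β - i))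

/-- The value of `Dop^[j]` on `Q ^ β`, for `Q s = A ^ 2 - 2 * s ^ 2 * B + s ^ 4`. -/
noncomputable def dopPow (β A B : ℝ) (j : ℕ) (s : ℝ) : ℝ :=
  (-1) ^ j * ∑ p ∈ Finset.range (j + 1), scaledFalling β (j - p) * quadCoeff j p *
    ((A ^ 2 - 2 * s ^ 2 * B + s ^ 4) ^ (β - j + p) * (B - s ^ 2) ^ (j - 2 * p))

theorem quadCoeff_zero_right (j : ℕ) : quadCoeff j 0 = 1 := by simp [quadCoeff]

theorem quadCoeff_eq_zero {j p : ℕ} (h : j < 2 * p) : quadCoeff j p = 0 := by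
  simp [quadCoeff, Nat.descFactorial_eq_zero_iff_lt.2 h]

theorem quadCoeff_eq_div {j p : ℕ} (h : 2 * p ≤ j) :
    quadCoeff j p = (j.factorial : ℝ) / ((j - 2 * p).factorial * p.factorial) := by
  have h1 : ((j - 2 * p).factorial : ℝ) * j.descFactorial (2 * p) = j.factorial := by
    exact_mod_cast Nat.factorial_mul_descFactorial h
  rw [quadCoeff, ← h1]
  field_simp

theorem quadCoeff_succ_succ (j p : ℕ) :
    quadCoeff (j + 1) (p + 1) =
      quadCoeff j (p + 1) + 2 * ((j - 2 * p : ℕ) : ℝ) * quadCoeff j p := by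
  rcases lt_or_ge j (2 * p + 1) with h | h
  · rw [quadCoeff_eq_zero (by omega), quadCoeff_eq_zero (by omega),
      show j - 2 * p = 0 by omega]
    simp
  · obtain ⟨m, rfl⟩ := Nat.exists_eq_add_of_le h
    simp only [quadCoeff, show 2 * (p + 1) = 2 * p + 1 + 1 by ring, Nat.succ_descFactorial_succ,
      Nat.descFactorial_succ, Nat.factorial_succ]
    rw [show 2 * p + 1 + m - (2 * p + 1) = m by omega,
      show 2 * p + 1 + m - 2 * p = m + 1 by omega]
    push_cast
    field_simp
    ring

theorem scaledFalling_succ (β : ℝ) (q : ℕ) :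
    scaledFalling β (q + 1) = scaledFalling β q * (4 * (β - q)) :=
  Finset.prod_range_succ _ _

theorem scaledFalling_half_odd {α q : ℕ} (h : q ≤ α) :
    scaledFalling ((2 * (α : ℝ) - 1) / 2) q =
      ((2 * α).factorial * (α - q).factorial : ℝ) /
        ((2 * α - 2 * q).factorial * α.factorial) := by
  induction q with
  | zero => simp [scaledFalling]; field_simp
  | succ q ih =>
    rw [scaledFalling_succ, ih (by omega)]
    obtain ⟨m, rfl⟩ := Nat.exists_eq_add_of_le h
    rw [show q + 1 + m - q = m + 1 by omega, show q + 1 + m - (q + 1) = m by omega,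
      show 2 * (q + 1 + m) - 2 * q = 2 * m + 1 + 1 by omega,
      show 2 * (q + 1 + m) - 2 * (q + 1) = 2 * m by omega]
    simp only [Nat.factorial_succ (2 * m + 1), Nat.factorial_succ (2 * m), Nat.factorial_succ m]
    push_cast
    field_simp
    ring

theorem dopPow_succ (β A B : ℝ) (j : ℕ) (s : ℝ) :
    dopPow β A B (j + 1) s =
      (-1) ^ (j + 1) * ∑ p ∈ Finset.range (j + 1), scaledFalling β (j - p) * quadCoeff j p *
        (4 * (β - j + p) * (A ^ 2 - 2 * s ^ 2 * B + s ^ 4) ^ (β - j + p - 1) *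
            (B - s ^ 2) ^ (j - 2 * p + 1) +
          2 * ((j - 2 * p : ℕ) : ℝ) * (A ^ 2 - 2 * s ^ 2 * B + s ^ 4) ^ (β - j + p) *
            (B - s ^ 2) ^ (j - 2 * p - 1)) := by
  set X := A ^ 2 - 2 * s ^ 2 * B + s ^ 4
  set Y := B - s ^ 2
  let T : ℕ → ℝ := fun p => scaledFalling β (j + 1 - p) *
    (X ^ (β - (j + 1 : ℕ) + p) * Y ^ (j + 1 - 2 * p))
  have key : ∑ p ∈ Finset.range (j + 1 + 1), quadCoeff (j + 1) p * T p =
      ∑ p ∈ Finset.range (j + 1), quadCoeff j p * T p +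
        ∑ p ∈ Finset.range (j + 1), 2 * ((j - 2 * p : ℕ) : ℝ) * quadCoeff j p * T (p + 1) := by
    have h0 : ∑ p ∈ Finset.range (j + 1), quadCoeff j p * T p =
        ∑ p ∈ Finset.range (j + 1 + 1), quadCoeff j p * T p := by
      rw [Finset.sum_range_succ _ (j + 1), quadCoeff_eq_zero (by omega), zero_mul, add_zero]
    rw [h0, Finset.sum_range_succ', Finset.sum_range_succ' _ (j + 1), quadCoeff_zero_right,
      quadCoeff_zero_right, add_right_comm, ← Finset.sum_add_distrib]
    congr 1
    refine Finset.sum_congr rfl fun p _ => ?_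
    rw [quadCoeff_succ_succ]
    ring
  have lhs : dopPow β A B (j + 1) s =
      (-1) ^ (j + 1) * ∑ p ∈ Finset.range (j + 1 + 1), quadCoeff (j + 1) p * T p := by
    unfold dopPow
    congr 1
    refine Finset.sum_congr rfl fun p _ => ?_
    simp only [T, X, Y]
    ring
  rw [lhs, key, ← Finset.sum_add_distrib]
  congr 1
  refine Finset.sum_congr rfl fun p hp => ?_
  have hpj : p ≤ j := by simpa [Nat.lt_succ_iff] using hp
  rcases lt_or_ge j (2 * p) with h | h
  · simp [quadCoeff_eq_zero h]
  · have e1 : j + 1 - p = j - p + 1 := by omega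
    have e2 : j + 1 - 2 * p = j - 2 * p + 1 := by omega
    have e3 : j + 1 - (p + 1) = j - p := by omega
    have e4 : j + 1 - 2 * (p + 1) = j - 2 * p - 1 := by omega
    have e5 : β - ((j + 1 : ℕ) : ℝ) + p = β - j + p - 1 := by push_cast; ring
    have e6 : β - ((j + 1 : ℕ) : ℝ) + ((p + 1 : ℕ) : ℝ) = β - j + p := by push_cast; ring
    simp only [T, e1, e2, e3, e4, e5, e6, scaledFalling_succ, Nat.cast_sub hpj]
    ring

theorem hasDerivAt_dopPow (β A B : ℝ) (j : ℕ) {s : ℝ}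
    (hs : 0 < A ^ 2 - 2 * s ^ 2 * B + s ^ 4) :
    HasDerivAt (dopPow β A B j) (s * dopPow β A B (j + 1) s) s := by
  have hX : HasDerivAt (fun s : ℝ => A ^ 2 - 2 * s ^ 2 * B + s ^ 4) (-(4 * s * (B - s ^ 2))) s := by
    have := (((hasDerivAt_pow 2 s).const_mul 2).mul_const B).const_sub (A ^ 2)
    refine (this.add (hasDerivAt_pow 4 s)).congr_deriv ?_
    push_cast
    ring
  have hY : HasDerivAt (fun s : ℝ => B - s ^ 2) (-(2 * s)) s := by
    refine ((hasDerivAt_pow 2 s).const_sub B).congr_deriv ?_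
    push_cast
    ring
  have h := (HasDerivAt.fun_sum (u := Finset.range (j + 1)) fun p _ =>
    ((hX.rpow_const (p := β - j + p) (Or.inl hs.ne')).mul
      (hY.pow (j - 2 * p))).const_mul (scaledFalling β (j - p) * quadCoeff j p)).const_mul
        ((-1 : ℝ) ^ j)
  refine h.congr_deriv ?_
  rw [dopPow_succ, pow_succ, mul_left_comm, mul_assoc, Finset.mul_sum, Finset.mul_sum]
  rw [Finset.mul_sum]
  refine Finset.sum_congr rfl fun p _ => ?_
  simp only [Pi.pow_apply]
  ring

theorem Dop_iterate_eq_dopPow (β A B : ℝ) {R : ℝ → ℝ}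
    (hR : ∀ s, R s = (A ^ 2 - 2 * s ^ 2 * B + s ^ 4) ^ β) (j : ℕ) :
    ∀ s, 0 < s → 0 < A ^ 2 - 2 * s ^ 2 * B + s ^ 4 → Dop^[j] R s = dopPow β A B j s := by
  induction j with
  | zero =>
    intro s _ _
    simp [dopPow, hR, scaledFalling, quadCoeff]
  | succ j ih =>
    intro s hs hQ
    have hev : Dop^[j] R =ᶠ[nhds s] dopPow β A B j := by
      have hc : ContinuousAt (fun s : ℝ => A ^ 2 - 2 * s ^ 2 * B + s ^ 4) s := by fun_prop
      filter_upwards [lt_mem_nhds hs, hc.eventually (lt_mem_nhds hQ)] with t ht hQt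
      exact ih t ht hQt
    rw [Function.iterate_succ_apply', Dop, hev.deriv_eq, (hasDerivAt_dopPow β A B j hQ).deriv]
    field_simp

theorem dopPow_half_odd_zero {α j : ℕ} (hj : j < α) {A : ℝ} (hA : 0 < A) (B : ℝ) :
    dopPow ((2 * (α : ℝ) - 1) / 2) A B j 0 =
      ∑ q ∈ Finset.Icc ((j + 1) / 2) j,
        (-1 : ℝ) ^ j *
            ((Nat.factorial (2 * α) : ℝ) * (Nat.factorial (α - q) : ℝ) *
              (Nat.factorial j : ℝ)) /
            ((Nat.factorial (2 * α - 2 * q) : ℝ) * (Nat.factorial α : ℝ) *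
              (Nat.factorial (2 * q - j) : ℝ) * (Nat.factorial (j - q) : ℝ)) *
          A ^ (2 * α - 2 * q - 1) * B ^ (2 * q - j) := by
  rw [dopPow, Finset.mul_sum]
  symm
  refine Finset.sum_of_injOn (fun q => j - q) ?_ ?_ ?_ ?_
  · intro a ha b hb hab
    simp only [Finset.coe_Icc, Set.mem_Icc] at ha hb hab
    omega
  · intro a ha
    simp only [Finset.coe_range, Set.mem_Iio]
    omega
  · intro p hp hp'
    have : j < 2 * p := by
      by_contra hlt
      simp only [Finset.mem_range] at hp
      exact hp' ⟨j - p, by simp only [Finset.coe_Icc, Set.mem_Icc]; omega, by dsimp only; omega⟩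
    simp [quadCoeff_eq_zero this]
  · intro q hq
    rw [Finset.mem_Icc] at hq
    have e1 : j - (j - q) = q := by omega
    have e2 : j - 2 * (j - q) = 2 * q - j := by omega
    have hpow : (A ^ 2 - 2 * (0 : ℝ) ^ 2 * B + 0 ^ 4) ^
        ((2 * (α : ℝ) - 1) / 2 - j + ((j - q : ℕ) : ℝ)) = A ^ (2 * α - 2 * q - 1) := by
      rw [show A ^ 2 - 2 * (0 : ℝ) ^ 2 * B + 0 ^ 4 = A ^ (2 : ℝ) by norm_num,
        ← Real.rpow_mul hA.le, ← Real.rpow_natCast]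
      congr 1
      rw [Nat.cast_sub hq.2, Nat.cast_sub (by omega), Nat.cast_sub (by omega)]
      push_cast
      ring
    rw [hpow, e1, quadCoeff_eq_div (by omega), e2, scaledFalling_half_odd (by omega)]
    simp only [ne_eq, OfNat.ofNat_ne_zero, not_false_eq_true, zero_pow, sub_zero]
    field_simp

/-- **`D_s`-derivatives of `R(s) = Q(s)^{(2α-1)/2}` at `s = 0`** (the computation
`D_s derivative` in the proof of Lemma `L4.3`).  For `z > w > 0`,
`Q(s) = (z²-w²)² - 2s²(z²+w²) + s⁴` and every `0 ≤ j ≤ α-1`, the function `D_s^j R`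
extends continuously to `s = 0` with value
`Σ_{q=⌈j/2⌉}^j (-1)^j (2α)! (α-q)! j! / ((2α-2q)! α! (2q-j)! (j-q)!)
  (z²-w²)^{2α-2q-1} (z²+w²)^{2q-j}`. -/
theorem Ds_derivatives_of_R_at_zero
    (α : ℕ) (hα : 1 ≤ α) (z w : ℝ) (hw : 0 < w) (hzw : w < z)
    (Q R : ℝ → ℝ)
    (hQ : ∀ s : ℝ, Q s = (z ^ 2 - w ^ 2) ^ 2 - 2 * s ^ 2 * (z ^ 2 + w ^ 2) + s ^ 4)
    (hR : ∀ s : ℝ, R s = Q s ^ ((2 * (α : ℝ) - 1) / 2)) :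
    ∀ j : ℕ, j ≤ α - 1 →
      Filter.Tendsto (Dop^[j] R) (nhdsWithin 0 (Set.Ioi 0))
        (nhds (∑ q ∈ Finset.Icc ((j + 1) / 2) j,
          (-1 : ℝ) ^ j *
              ((Nat.factorial (2 * α) : ℝ) * (Nat.factorial (α - q) : ℝ) *
                (Nat.factorial j : ℝ)) /
              ((Nat.factorial (2 * α - 2 * q) : ℝ) * (Nat.factorial α : ℝ) *
                (Nat.factorial (2 * q - j) : ℝ) * (Nat.factorial (j - q) : ℝ)) *
            (z ^ 2 - w ^ 2) ^ (2 * α - 2 * q - 1) * (z ^ 2 + w ^ 2) ^ (2 * q - j))) := by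
  intro j hj
  have hA : 0 < z ^ 2 - w ^ 2 := by nlinarith
  have hQ0 : 0 < (z ^ 2 - w ^ 2) ^ 2 - 2 * (0 : ℝ) ^ 2 * (z ^ 2 + w ^ 2) + 0 ^ 4 := by
    have := pow_pos hA 2
    simpa using this
  rw [← dopPow_half_odd_zero (by omega) hA]
  refine ((hasDerivAt_dopPow _ _ _ j hQ0).continuousAt.tendsto.mono_left
    nhdsWithin_le_nhds).congr' ?_
  have hc : ContinuousAt (fun s : ℝ =>
      (z ^ 2 - w ^ 2) ^ 2 - 2 * s ^ 2 * (z ^ 2 + w ^ 2) + s ^ 4) 0 := by fun_prop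
  filter_upwards [self_mem_nhdsWithin,
    nhdsWithin_le_nhds (hc.eventually (lt_mem_nhds hQ0))] with s hs hQs
  exact (Dop_iterate_eq_dopPow _ _ _ (fun t => by rw [hR, hQ]) j s hs hQs).symm
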